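/- Let H be a bipartite graph with t vertices whose minimal vertex cover has size q ≥ 1. Then for all ε ∈ (0,1), the probability that ‖R_H‖ > 2·t^t·(e·t·(ln(8·n^q/ε)/(2q) + 1))^q · n^{(t−q)/2} is less than ε. -/

import Mathlib

noncomputable def opNorm {α β : Type*} [Fintype α] [Fintype β] [DecidableEq β]
    (M : Matrix α β ℝ) : ℝ :=
  ‖LinearMap.toContinuousLinearMap (Matrix.toEuclideanLin M)‖

def sgn (b : Bool) : ℝ := if b then 1 else -1

noncomputable def Pr {n : ℕ} (P : (Sym2 (Fin n) → Bool) → Prop) : ℝ := by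
  classical
  exact ((Finset.univ.filter P).card : ℝ) / (Fintype.card (Sym2 (Fin n) → Bool))

noncomputable def Ex {n : ℕ} (f : (Sym2 (Fin n) → Bool) → ℝ) : ℝ :=
  (∑ g : Sym2 (Fin n) → Bool, f g) / (Fintype.card (Sym2 (Fin n) → Bool))

noncomputable def Rmat {n : ℕ} (g : Sym2 (Fin n) → Bool) : Matrix (Fin n) (Fin n) ℝ :=
  Matrix.of fun i j => if i = j then 0 else sgn (g s(i, j))

def cyc {m : ℕ} (j : Fin m) : Fin m := ⟨((j : ℕ) + 1) % m, Nat.mod_lt _ j.pos⟩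

abbrev SubsetsCard (n x : ℕ) := {A : Finset (Fin n) // A.card = x}

def tup {n x : ℕ} (A : SubsetsCard n x) (i : Fin x) : Fin n :=
  (A.1.orderIsoOfFin A.2 i : Fin n)

noncomputable def RH {n x y : ℕ} (E : Finset (Fin x × Fin y)) (g : Sym2 (Fin n) → Bool) :
    Matrix (SubsetsCard n x) (SubsetsCard n y) ℝ :=
  Matrix.of fun A B =>
    if Disjoint A.1 B.1 then ∏ e ∈ E, sgn (g s(tup A e.1, tup B e.2)) else 0

def IsVertexCover {x y : ℕ} (E : Finset (Fin x × Fin y)) (S : Finset (Fin x ⊕ Fin y)) : Prop :=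
  ∀ e ∈ E, Sum.inl e.1 ∈ S ∨ Sum.inr e.2 ∈ S

section Moments

open Finset

section Koenig

variable {α β : Type*} [DecidableEq α] [DecidableEq β]

/-- One half of König's theorem: the left part `S` of a minimum vertex cover `(S, T)` of a bipartite
graph can be matched into the complement of the right part `T`. -/
theorem exists_injective_of_min_cover (E : Finset (α × β)) (S : Finset α) (T : Finset β)
    (hcov : ∀ e ∈ E, e.1 ∈ S ∨ e.2 ∈ T)
    (hmin : ∀ (S' : Finset α) (T' : Finset β), (∀ e ∈ E, e.1 ∈ S' ∨ e.2 ∈ T') →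
      #S + #T ≤ #S' + #T') :
    ∃ f : S → β, Function.Injective f ∧ ∀ s : S, ((s : α), f s) ∈ E ∧ f s ∉ T := by
  classical
  let N : S → Finset β := fun s => {b ∈ E.image Prod.snd | ((s : α), b) ∈ E ∧ b ∉ T}
  obtain ⟨f, hf, hfN⟩ := (Finset.all_card_le_biUnion_card_iff_exists_injective N).1 (by
    intro X
    have hX : X.image Subtype.val ⊆ S := by
      intro a ha
      obtain ⟨s, -, rfl⟩ := mem_image.1 ha
      exact s.2
    have h := hmin (S \ X.image Subtype.val) (T ∪ X.biUnion N) (by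
      intro e he
      by_cases hT : e.2 ∈ T
      · exact Or.inr (mem_union_left _ hT)
      have hS : e.1 ∈ S := (hcov e he).resolve_right hT
      by_cases hX' : (⟨e.1, hS⟩ : S) ∈ X
      · right
        refine mem_union_right _ (mem_biUnion.2 ⟨_, hX', ?_⟩)
        exact mem_filter.2 ⟨mem_image_of_mem _ he, he, hT⟩
      · left
        refine mem_sdiff.2 ⟨hS, fun h => ?_⟩
        obtain ⟨s, hs, hse⟩ := mem_image.1 h
        exact hX' (by convert hs; exact hse.symm))
    have h1 := card_union_le T (X.biUnion N)
    have h2 := card_sdiff_add_card_eq_card hX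
    rw [card_image_of_injective _ Subtype.val_injective] at h2
    omega)
  exact ⟨f, hf, fun s => (mem_filter.1 (hfN s)).2⟩

/-- König's theorem: a minimum vertex cover of a bipartite graph is as large as some matching. -/
theorem exists_matching_of_min_cover (E : Finset (α × β)) (S : Finset α) (T : Finset β)
    (hcov : ∀ e ∈ E, e.1 ∈ S ∨ e.2 ∈ T)
    (hmin : ∀ (S' : Finset α) (T' : Finset β), (∀ e ∈ E, e.1 ∈ S' ∨ e.2 ∈ T') →
      #S + #T ≤ #S' + #T') :
    ∃ m : S ⊕ T → α × β, (∀ i, m i ∈ E) ∧ Function.Injective (fun i => (m i).1) ∧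
      Function.Injective (fun i => (m i).2) := by
  obtain ⟨f, hf, hfE⟩ := exists_injective_of_min_cover E S T hcov hmin
  obtain ⟨h, hh, hhE⟩ := exists_injective_of_min_cover (E.image Prod.swap) T S
    (by
      intro e he
      obtain ⟨e', he', rfl⟩ := mem_image.1 he
      exact (hcov e' he').symm)
    (by
      intro T' S' hc
      have := hmin S' T' (fun e he => (hc e.swap (mem_image_of_mem _ he)).symm)
      omega)
  refine ⟨Sum.elim (fun s => (s, f s)) (fun t => (h t, t)), ?_, ?_, ?_⟩
  · rintro (s | t)
    · exact (hfE s).1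
    · simpa using (hhE t).1
  · rintro (s | t) (s' | t') hst
    · exact congrArg Sum.inl (Subtype.ext hst)
    · exact absurd (show h t' ∈ S from (show (s : α) = h t' from hst) ▸ s.2) (hhE t').2
    · exact absurd (show h t ∈ S from (show h t = (s' : α) from hst) ▸ s'.2) (hhE t).2
    · exact congrArg Sum.inr (hh hst)
  · rintro (s | t) (s' | t') hst
    · exact congrArg Sum.inl (hf hst)
    · exact absurd (show f s ∈ T from (show f s = (t' : β) from hst) ▸ t'.2) (hfE s).2
    · exact absurd (show f s' ∈ T from (show (t : β) = f s' from hst) ▸ t.2) (hfE s').2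
    · exact congrArg Sum.inr (Subtype.ext hst)

end Koenig

theorem exists_matching_of_isLeast_cover {x y q : ℕ} {E : Finset (Fin x × Fin y)}
    (hq : IsLeast {m | ∃ S : Finset (Fin x ⊕ Fin y), IsVertexCover E S ∧ S.card = m} q) :
    ∃ m : Fin q → Fin x × Fin y, (∀ i, m i ∈ E) ∧ Function.Injective (fun i => (m i).1) ∧
      Function.Injective (fun i => (m i).2) := by
  obtain ⟨⟨S, hS, hSq⟩, hmin⟩ := hq
  obtain ⟨m, hm, hm1, hm2⟩ := exists_matching_of_min_cover E S.toLeft S.toRight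
    (by simpa [IsVertexCover] using hS)
    (by
      intro S' T' hc
      rw [card_toLeft_add_card_toRight, hSq]
      exact hmin ⟨S'.disjSum T', by simpa [IsVertexCover] using hc, by simp⟩)
  have hcard : Fintype.card (S.toLeft ⊕ S.toRight) = q := by
    rw [Fintype.card_sum, Fintype.card_coe, Fintype.card_coe, card_toLeft_add_card_toRight, hSq]
  let φ := (Fintype.equivFinOfCardEq hcard).symm
  exact ⟨m ∘ φ, fun i => hm _, hm1.comp φ.injective, hm2.comp φ.injective⟩

section EvenWalks

variable {V : Type*} [DecidableEq V]

/-- The sign `(-1) ^ N`, where `N` is the number of times the closed walk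
`b 0, a 0, b 1, a 1, …, b 0` uses the edge with `a`-endpoint `u` and `b`-endpoint `v`. -/
def edgeSign {k : ℕ} (a b : Fin k → V) (u v : V) : ℝ :=
  ∏ s, ((if a s = u ∧ b s = v then -1 else 1) * (if a s = u ∧ b (cyc s) = v then -1 else 1))

/-- The closed walk `b 0, a 0, b 1, a 1, …, b 0` uses every edge an even number of times. -/
def EvenWalk {k : ℕ} (a b : Fin k → V) : Prop := ∀ u v, edgeSign a b u v = 1

theorem edgeSign_eq_one_or {k : ℕ} (a b : Fin k → V) (u v : V) :
    edgeSign a b u v = 1 ∨ edgeSign a b u v = -1 := by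
  unfold edgeSign
  refine Finset.prod_induction _ (fun r : ℝ => r = 1 ∨ r = -1) ?_ (Or.inl rfl) ?_
  · rintro _ _ (rfl | rfl) (rfl | rfl) <;> simp
  · intro s _
    split_ifs <;> simp

theorem EvenWalk.card_edges_le {k : ℕ} {a b : Fin k → V} (h : EvenWalk a b) :
    #((univ : Finset (Fin k × Bool)).image
      fun s => (a s.1, b (if s.2 then cyc s.1 else s.1))) ≤ k := by
  set p : Fin k × Bool → V × V := fun s => (a s.1, b (if s.2 then cyc s.1 else s.1)) with hp
  have h2 : ∀ z ∈ univ.image p, 2 ≤ #{s ∈ univ | p s = z} := by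
    intro z hz
    have hsign : edgeSign a b z.1 z.2 = (-1) ^ #{s ∈ univ | p s = z} := by
      rw [← prod_const, prod_filter, Fintype.prod_prod_type]
      simp [edgeSign, hp, Prod.ext_iff, mul_comm]
    have hpos : #{s ∈ univ | p s = z} ≠ 0 := by
      obtain ⟨s, -, hs⟩ := mem_image.1 hz
      exact (card_pos.2 ⟨s, by simp [hs]⟩).ne'
    have hone : #{s ∈ univ | p s = z} ≠ 1 := by
      intro h1
      rw [h1, h] at hsign
      norm_num at hsign
    omega
  have := mul_card_image_le_card univ 2 h2
  simp at this
  omega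

/-- A walk visits at most one vertex more than it uses edges. -/
theorem card_vertices_le_card_edges_succ (a b : ℕ → V) (m : ℕ) :
    #((range (m + 1)).image b ∪ (range m).image a) ≤
      #((range m).image (fun s => (a s, b s)) ∪ (range m).image fun s => (a s, b (s + 1))) + 1 := by
  induction m with
  | zero => simp
  | succ m ih =>
    set S := (range (m + 1)).image b ∪ (range m).image a with hS
    set F := (range m).image (fun s => (a s, b s)) ∪ (range m).image fun s => (a s, b (s + 1))
      with hF
    have hS' : (range (m + 1 + 1)).image b ∪ (range (m + 1)).image a =
        insert (b (m + 1)) (insert (a m) S) := by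
      rw [range_add_one (n := m + 1), image_insert, range_add_one (n := m), image_insert, hS,
        range_add_one, image_insert, image_insert]
      ext z
      simp only [mem_union, mem_insert]
      tauto
    have hF' : (range (m + 1)).image (fun s => (a s, b s)) ∪
        (range (m + 1)).image (fun s => (a s, b (s + 1))) =
        insert (a m, b (m + 1)) (insert (a m, b m) F) := by
      rw [range_add_one, image_insert, image_insert, hF]
      ext z
      simp only [mem_union, mem_insert]
      tauto
    have hFS : ∀ z ∈ F, z.1 ∈ S ∧ z.2 ∈ S := by
      intro z hz
      simp only [hF, hS, mem_union, mem_image, mem_range] at hz ⊢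
      rcases hz with ⟨s, hs, rfl⟩ | ⟨s, hs, rfl⟩
      · exact ⟨Or.inr ⟨s, hs, rfl⟩, Or.inl ⟨s, by omega, rfl⟩⟩
      · exact ⟨Or.inr ⟨s, hs, rfl⟩, Or.inl ⟨s + 1, by omega, rfl⟩⟩
    have hbS : b m ∈ S := mem_union_left _ (mem_image_of_mem _ (by simp))
    rw [hS', hF']
    have h1 : #(insert (a m) S) ≤ #(insert (a m, b m) F) + 1 := by
      by_cases ha : a m ∈ S
      · rw [insert_eq_of_mem ha]
        exact ih.trans (Nat.succ_le_succ (card_le_card (subset_insert _ _)))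
      · rw [card_insert_of_notMem ha,
          card_insert_of_notMem fun h => ha (hFS _ h).1]
        omega
    by_cases hb : b (m + 1) ∈ insert (a m) S
    · rw [insert_eq_of_mem hb]
      exact h1.trans (Nat.succ_le_succ (card_le_card (subset_insert _ _)))
    · rw [card_insert_of_notMem hb, card_insert_of_notMem (a := (a m, b (m + 1)))]
      · omega
      · intro h
        rcases mem_insert.1 h with h | h
        · rw [show b (m + 1) = b m from (Prod.ext_iff.1 h).2] at hb
          exact hb (mem_insert_of_mem hbS)
        · exact hb (mem_insert_of_mem (hFS _ h).2)

theorem EvenWalk.card_vertices_le {k : ℕ} {a b : Fin k → V} (h : EvenWalk a b) :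
    #((univ : Finset (Fin k ⊕ Fin k)).image (Sum.elim a b)) ≤ k + 1 := by
  rcases Nat.eq_zero_or_pos k with rfl | hk
  · simp
  let r : ℕ → Fin k := fun s => ⟨s % k, Nat.mod_lt _ hk⟩
  have hr : ∀ s : Fin k, r s = s := fun s => Fin.ext (Nat.mod_eq_of_lt s.2)
  have hr1 : ∀ s, r (s + 1) = cyc (r s) := fun s => Fin.ext (by simp [r, cyc])
  refine le_trans (card_le_card ?_) ((card_vertices_le_card_edges_succ (a ∘ r) (b ∘ r) k).trans
    (Nat.succ_le_succ (le_trans (card_le_card ?_) h.card_edges_le)))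
  · intro z hz
    obtain ⟨s | s, -, rfl⟩ := mem_image.1 hz
    · exact mem_union_right _ (mem_image.2 ⟨s, by simp, by simp [hr]⟩)
    · exact mem_union_left _ (mem_image.2 ⟨s, by simp, by simp [hr]⟩)
  · intro z hz
    rcases mem_union.1 hz with hz | hz
    · obtain ⟨s, -, rfl⟩ := mem_image.1 hz
      exact mem_image.2 ⟨(r s, false), by simp, by simp⟩
    · obtain ⟨s, -, rfl⟩ := mem_image.1 hz
      exact mem_image.2 ⟨(r s, true), by simp, by simp [hr1]⟩

end EvenWalks

/-- The number of functions taking at most `d` values. -/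
theorem card_filter_card_image_le {ι V : Type*} [Fintype ι] [DecidableEq ι] [Fintype V]
    [DecidableEq V] [Nonempty V] (d : ℕ) :
    #{f : ι → V | #(univ.image f) ≤ d} ≤ d ^ Fintype.card ι * Fintype.card V ^ d := by
  classical
  have hsub : ({f : ι → V | #(univ.image f) ≤ d} : Finset (ι → V)) ⊆
      (univ : Finset ((ι → Fin d) × (Fin d → V))).image fun p => p.2 ∘ p.1 := by
    intro f hf
    have hf' : Fintype.card (univ.image f) ≤ Fintype.card (Fin d) := by
      rw [Fintype.card_coe, Fintype.card_fin]
      exact (mem_filter.1 hf).2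
    obtain ⟨φ⟩ := Function.Embedding.nonempty_of_card_le hf'
    obtain ⟨v⟩ := ‹Nonempty V›
    refine mem_image.2 ⟨(fun i => φ ⟨f i, mem_image_of_mem _ (mem_univ _)⟩,
      Function.extend φ Subtype.val fun _ => v), mem_univ _, ?_⟩
    funext i
    simp [φ.injective.extend_apply]
  refine (card_le_card hsub).trans (card_image_le.trans ?_)
  simp

/-- The number of even closed walks of length `2 * k` on `V`. -/
theorem card_evenWalk_le {V : Type*} [Fintype V] [DecidableEq V] [Nonempty V] (k : ℕ) :
    Nat.card {p : (Fin k → V) × (Fin k → V) // EvenWalk p.1 p.2} ≤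
      (k + 1) ^ (2 * k) * Fintype.card V ^ (k + 1) := by
  classical
  have h := card_filter_card_image_le (ι := Fin k ⊕ Fin k) (V := V) (k + 1)
  rw [Fintype.card_sum, Fintype.card_fin, ← two_mul] at h
  refine le_trans ?_ h
  rw [← Fintype.card_coe, ← Nat.card_eq_fintype_card]
  refine Nat.card_le_card_of_injective
    (fun p => ⟨Sum.elim p.1.1 p.1.2, by simpa using p.2.card_vertices_le⟩) ?_
  rintro ⟨⟨a, b⟩, _⟩ ⟨⟨a', b'⟩, _⟩ h
  have h' := Subtype.ext_iff.1 h
  have ha : a = a' := funext fun i => congrFun h' (Sum.inl i)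
  have hb : b = b' := funext fun i => congrFun h' (Sum.inr i)
  simp [ha, hb]

theorem two_mul_card_matching_le {α β : Type*} [Fintype α] [Fintype β] {q : ℕ}
    (m : Fin q → α × β) (hm1 : Function.Injective fun i => (m i).1)
    (hm2 : Function.Injective fun i => (m i).2) :
    2 * q ≤ Fintype.card α + Fintype.card β := by
  have h := Fintype.card_le_of_injective _ (hm1.sumMap hm2)
  simp only [Fintype.card_sum, Fintype.card_fin] at h
  omega

/-- The number of vertex labellings all of whose restrictions to the edges of a matching lie in a
given set. -/
theorem card_labellings_le {α β W : Type*} [Fintype α] [Fintype β] [Fintype W] {q : ℕ}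
    (m : Fin q → α × β) (hm1 : Function.Injective fun i => (m i).1)
    (hm2 : Function.Injective fun i => (m i).2) (P : W × W → Prop) :
    Nat.card {φ : α ⊕ β → W // ∀ i, P (φ (Sum.inl (m i).1), φ (Sum.inr (m i).2))} ≤
      Nat.card {p : W × W // P p} ^ q *
        Fintype.card W ^ (Fintype.card α + Fintype.card β - 2 * q) := by
  classical
  let μ : Fin q ⊕ Fin q → α ⊕ β := Sum.map (fun i => (m i).1) (fun i => (m i).2)
  have hμ : Function.Injective μ := hm1.sumMap hm2
  have hcard : Fintype.card (Set.range μ) = 2 * q := by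
    rw [Set.card_range_of_injective hμ]
    simp [two_mul]
  have hcompl : Fintype.card {v // v ∉ Set.range μ} =
      Fintype.card α + Fintype.card β - 2 * q := by
    rw [Fintype.card_subtype_compl, Fintype.card_sum]
    congr 1
  have hR : Nat.card ((Fin q → {p : W × W // P p}) × ({v // v ∉ Set.range μ} → W)) =
      Nat.card {p : W × W // P p} ^ q *
        Fintype.card W ^ (Fintype.card α + Fintype.card β - 2 * q) := by
    rw [Nat.card_prod, Nat.card_fun, Nat.card_fun, ← hcompl]
    simp
  rw [← hR]
  refine Nat.card_le_card_of_injective (fun φ => (fun i => ⟨_, φ.2 i⟩, fun v => φ.1 v)) ?_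
  rintro ⟨φ, hφ⟩ ⟨ψ, hψ⟩ h
  simp only [Prod.mk.injEq] at h
  obtain ⟨h1, h2⟩ := h
  refine Subtype.ext (funext fun v => ?_)
  by_cases hv : v ∈ Set.range μ
  · obtain ⟨i | i, rfl⟩ := hv
    · exact (Prod.ext_iff.1 (Subtype.ext_iff.1 (congrFun h1 i))).1
    · exact (Prod.ext_iff.1 (Subtype.ext_iff.1 (congrFun h1 i))).2
  · exact congrFun h2 ⟨v, hv⟩

section Trace

variable {ι : Type*} [Fintype ι] [DecidableEq ι]

theorem pow_succ_apply_eq_sum_paths (A : Matrix ι ι ℝ) (k : ℕ) (i j : ι) :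
    (A ^ (k + 1)) i j =
      ∑ w : Fin k → ι, ∏ s : Fin (k + 1),
        A ((Fin.cons i w : Fin (k + 1) → ι) s) ((Fin.snoc w j : Fin (k + 1) → ι) s) := by
  induction k generalizing i with
  | zero => simp [Fin.snoc]
  | succ k ih =>
    rw [pow_succ', Matrix.mul_apply,
      ← (Fin.consEquiv fun _ : Fin (k + 1) => ι).sum_comp, Fintype.sum_prod_type]
    refine sum_congr rfl fun l _ => ?_
    rw [ih, mul_sum]
    refine sum_congr rfl fun w _ => ?_
    rw [Fin.prod_univ_succ (n := k + 1)]
    have hcons : (Fin.consEquiv fun _ : Fin (k + 1) => ι) (l, w) = Fin.cons l w := rfl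
    have hsnoc : (Fin.snoc (Fin.cons l w : Fin (k + 1) → ι) j : Fin (k + 2) → ι) =
        Fin.cons l (Fin.snoc w j : Fin (k + 1) → ι) := (Fin.cons_snoc_eq_snoc_cons ..).symm
    simp only [hcons, hsnoc, Fin.cons_succ, Fin.cons_zero]

theorem trace_pow_eq_sum_closed_walks (A : Matrix ι ι ℝ) {k : ℕ} (hk : 1 ≤ k) :
    (A ^ k).trace = ∑ w : Fin k → ι, ∏ s, A (w s) (w (cyc s)) := by
  obtain ⟨k, rfl⟩ := Nat.exists_eq_add_of_le' hk
  rw [Matrix.trace, ← (Fin.consEquiv fun _ : Fin (k + 1) => ι).sum_comp, Fintype.sum_prod_type]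
  refine sum_congr rfl fun i _ => ?_
  rw [Matrix.diag_apply, pow_succ_apply_eq_sum_paths]
  refine sum_congr rfl fun w _ => prod_congr rfl fun s _ => ?_
  simp only [Fin.consEquiv_apply]
  congr 1
  induction s using Fin.lastCases with
  | last =>
    have : cyc (Fin.last k) = 0 := Fin.ext (by simp [cyc])
    simp [this]
  | cast s =>
    have : cyc s.castSucc = s.succ := Fin.ext (by simp [cyc])
    simp [this]

/-- The trace of `(Mᵀ * M) ^ k` as a sum over closed walks of length `2 * k`. -/
theorem trace_transpose_mul_self_pow {κ : Type*} [Fintype κ] (M : Matrix κ ι ℝ)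
    {k : ℕ} (hk : 1 ≤ k) :
    ((M.transpose * M) ^ k).trace =
      ∑ B : Fin k → ι, ∑ A : Fin k → κ, ∏ s, (M (A s) (B s) * M (A s) (B (cyc s))) := by
  classical
  rw [trace_pow_eq_sum_closed_walks _ hk]
  refine sum_congr rfl fun B _ => ?_
  simp only [Matrix.mul_apply, Matrix.transpose_apply]
  rw [prod_univ_sum, Fintype.piFinset_univ]

open scoped Matrix.Norms.L2Operator in
theorem opNorm_pow_le_trace {κ : Type*} [Fintype κ] (M : Matrix κ ι ℝ) {k : ℕ} (hk : 1 ≤ k) :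
    opNorm M ^ (2 * k) ≤ ((M.transpose * M) ^ k).trace := by
  have hM : opNorm M = ‖M‖ := (Matrix.l2_opNorm_def M).symm
  set A := M.transpose * M with hA
  have hnorm : ‖A‖ = ‖M‖ ^ 2 := by
    rw [pow_two, ← Matrix.l2_opNorm_conjTranspose_mul_self,
      Matrix.conjTranspose_eq_transpose_of_trivial]
  have hpsd : A.PosSemidef := by
    have := Matrix.posSemidef_conjTranspose_mul_self M
    rwa [Matrix.conjTranspose_eq_transpose_of_trivial] at this
  obtain ⟨U, ev, hev, hspec⟩ : ∃ (U : unitary (Matrix ι ι ℝ)) (ev : ι → ℝ), (∀ i, 0 ≤ ev i) ∧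
      A = Unitary.conjStarAlgAut ℝ _ U (Matrix.diagonal ev) :=
    ⟨_, _, hpsd.eigenvalues_nonneg, hpsd.isHermitian.spectral_theorem⟩
  have hnormD : ‖A‖ = ‖ev‖ := by
    rw [hspec, Unitary.conjStarAlgAut_apply, ← Unitary.coe_star, CStarRing.norm_mul_coe_unitary,
      CStarRing.norm_coe_unitary_mul, Matrix.l2_opNorm_diagonal]
  have htrace : (A ^ k).trace = ∑ i, ev i ^ k := by
    rw [hspec, ← map_pow, Unitary.conjStarAlgAut_apply, Matrix.trace_mul_comm, ← mul_assoc,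
      Unitary.coe_star_mul_self, one_mul, Matrix.diagonal_pow, Matrix.trace_diagonal]
    rfl
  rw [hM, pow_mul, ← hnorm, hnormD, htrace]
  rcases isEmpty_or_nonempty ι with hι | hι
  · simp [Subsingleton.elim ev 0, zero_pow (by omega : k ≠ 0)]
  obtain ⟨i, hi⟩ := Finite.exists_max ev
  have hle : ‖ev‖ ≤ ev i := by
    refine (pi_norm_le_iff_of_nonneg (hev i)).2 fun j => ?_
    rw [Real.norm_of_nonneg (hev j)]
    exact hi j
  exact (pow_le_pow_left₀ (norm_nonneg _) hle k).trans
    (single_le_sum (f := fun j => ev j ^ k) (fun j _ => pow_nonneg (hev j) k) (mem_univ i))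

end Trace

section Restricted

variable {n x y : ℕ}

/-- The submatrix of `RH E g` on the rows and columns whose vertices have the prescribed colours:
the vertex playing the role `v` of the pattern must have colour `v`. -/
noncomputable def colouredRH (c : Fin n → Fin x ⊕ Fin y) (E : Finset (Fin x × Fin y))
    (g : Sym2 (Fin n) → Bool) : Matrix (SubsetsCard n x) (SubsetsCard n y) ℝ :=
  Matrix.of fun A B =>
    if (∀ i, c (tup A i) = Sum.inl i) ∧ (∀ j, c (tup B j) = Sum.inr j) then RH E g A B else 0

theorem abs_sgn (b : Bool) : |sgn b| = 1 := by
  cases b <;> simp [sgn]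

theorem abs_colouredRH_le_one (c : Fin n → Fin x ⊕ Fin y) (E : Finset (Fin x × Fin y))
    (g : Sym2 (Fin n) → Bool) (A : SubsetsCard n x) (B : SubsetsCard n y) :
    |colouredRH c E g A B| ≤ 1 := by
  simp only [colouredRH, RH, Matrix.of_apply]
  split_ifs <;> simp [abs_prod, abs_sgn]

/-- Flip the status of the pair `z`. -/
def flipAt (z : Sym2 (Fin n)) (g : Sym2 (Fin n) → Bool) : Sym2 (Fin n) → Bool :=
  Function.update g z (!g z)

theorem flipAt_involutive (z : Sym2 (Fin n)) : Function.Involutive (flipAt z) := by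
  intro g
  simp [flipAt]

theorem sgn_flipAt (z w : Sym2 (Fin n)) (g : Sym2 (Fin n) → Bool) :
    sgn (flipAt z g w) = (if w = z then -1 else 1) * sgn (g w) := by
  by_cases h : w = z
  · subst h
    cases hg : g w <;> simp [flipAt, sgn, hg]
  · simp [flipAt, h]

theorem sum_eq_zero_of_flipAt_neg (z : Sym2 (Fin n)) (F : (Sym2 (Fin n) → Bool) → ℝ)
    (hF : ∀ g, F (flipAt z g) = -F g) : ∑ g, F g = 0 := by
  have h := Equiv.sum_comp (flipAt_involutive z).toPerm F
  simp only [Function.Involutive.coe_toPerm, hF, sum_neg_distrib] at h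
  linarith

theorem colouredRH_flipAt {c : Fin n → Fin x ⊕ Fin y} {E : Finset (Fin x × Fin y)}
    {e : Fin x × Fin y} (he : e ∈ E) {u v : Fin n} (hu : c u = Sum.inl e.1)
    (hv : c v = Sum.inr e.2) (g : Sym2 (Fin n) → Bool) (A : SubsetsCard n x)
    (B : SubsetsCard n y) :
    colouredRH c E (flipAt s(u, v) g) A B =
      (if tup A e.1 = u ∧ tup B e.2 = v then -1 else 1) * colouredRH c E g A B := by
  simp only [colouredRH, RH, Matrix.of_apply, sgn_flipAt, prod_mul_distrib]
  split_ifs with hc hd h h <;> try simp only [mul_zero]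
  all_goals
    obtain ⟨hA, hB⟩ := hc
    have key : ∀ e' ∈ E, s(tup A e'.1, tup B e'.2) = s(u, v) ↔
        e' = e ∧ tup A e.1 = u ∧ tup B e.2 = v := by
      intro e' _
      constructor
      · intro h'
        rcases Sym2.eq_iff.1 h' with ⟨h1, h2⟩ | ⟨h1, h2⟩
        · have h3 := hA e'.1
          have h4 := hB e'.2
          rw [h1, hu] at h3
          rw [h2, hv] at h4
          have : e' = e := Prod.ext (Sum.inl.inj h3).symm (Sum.inr.inj h4).symm
          subst this
          exact ⟨rfl, h1, h2⟩
        · have h3 := hA e'.1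
          rw [h1, hv] at h3
          cases h3
      · rintro ⟨rfl, h1, h2⟩
        rw [h1, h2]
    rw [prod_congr rfl fun e' he' => if_congr (key e' he') rfl rfl]
    simp [h, he]

/-- The expected contribution of a closed walk of rows and columns is nonzero only if the walk is
even on every edge of the pattern. -/
theorem sum_prod_colouredRH_le (c : Fin n → Fin x ⊕ Fin y) (E : Finset (Fin x × Fin y)) {k : ℕ}
    (A : Fin k → SubsetsCard n x) (B : Fin k → SubsetsCard n y) :
    ∑ g, ∏ s, (colouredRH c E g (A s) (B s) * colouredRH c E g (A s) (B (cyc s))) ≤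
      (Fintype.card (Sym2 (Fin n) → Bool) : ℝ) *
        open Classical in
        if ∀ e ∈ E, EvenWalk (fun s => tup (A s) e.1) (fun s => tup (B s) e.2) then 1 else 0 := by
  split_ifs with hgood
  · rw [mul_one, ← card_univ, ← nsmul_one]
    refine sum_le_card_nsmul _ _ _ fun g _ => ?_
    refine (le_abs_self _).trans ?_
    rw [abs_prod]
    refine prod_le_one (fun s _ => abs_nonneg _) fun s _ => ?_
    rw [abs_mul]
    exact mul_le_one₀ (abs_colouredRH_le_one ..) (abs_nonneg _) (abs_colouredRH_le_one ..)
  rw [mul_zero]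
  by_cases hc : ∀ s, (∀ i, c (tup (A s) i) = Sum.inl i) ∧ ∀ j, c (tup (B s) j) = Sum.inr j
  · push Not at hgood
    obtain ⟨e, he, hw⟩ := hgood
    simp only [EvenWalk, not_forall] at hw
    obtain ⟨u, v, huv⟩ := hw
    have hsign := (edgeSign_eq_one_or _ _ u v).resolve_left huv
    have hcol : c u = Sum.inl e.1 ∧ c v = Sum.inr e.2 := by
      obtain ⟨s, -, hs⟩ := exists_ne_one_of_prod_ne_one huv
      by_cases h1 : tup (A s) e.1 = u ∧ tup (B s) e.2 = v
      · rw [← h1.1, ← h1.2]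
        exact ⟨(hc s).1 _, (hc s).2 _⟩
      by_cases h2 : tup (A s) e.1 = u ∧ tup (B (cyc s)) e.2 = v
      · rw [← h2.1, ← h2.2]
        exact ⟨(hc s).1 _, (hc _).2 _⟩
      simp [h1, h2] at hs
    refine (sum_eq_zero_of_flipAt_neg s(u, v) _ fun g => ?_).le
    rw [← neg_one_mul, ← hsign, edgeSign, ← prod_mul_distrib]
    refine prod_congr rfl fun s _ => ?_
    rw [colouredRH_flipAt he hcol.1 hcol.2, colouredRH_flipAt he hcol.1 hcol.2]
    ring
  · refine (sum_eq_zero fun g _ => ?_).le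
    obtain ⟨s, hs⟩ := not_forall.1 hc
    refine prod_eq_zero (mem_univ s) ?_
    simp [colouredRH, hs]

theorem tup_injective (A : SubsetsCard n x) : Function.Injective (tup A) := by
  intro i j h
  simpa [tup, Subtype.ext_iff] using h

theorem tup_mem (A : SubsetsCard n x) (i : Fin x) : tup A i ∈ A.1 :=
  (A.1.orderIsoOfFin A.2 i).2

theorem eq_of_tup_eq {A A' : SubsetsCard n x} (h : tup A = tup A') : A = A' := by
  have key : ∀ A : SubsetsCard n x, (A.1 : Set (Fin n)) = Set.range (tup A) := by
    intro A
    rw [← A.1.range_orderEmbOfFin A.2]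
    rfl
  exact Subtype.ext (coe_injective (by rw [key, key, h]))

theorem card_even_closed_walks_le (hn : 1 ≤ n) {q : ℕ} {E : Finset (Fin x × Fin y)}
    (m : Fin q → Fin x × Fin y) (hm : ∀ i, m i ∈ E) (hm1 : Function.Injective fun i => (m i).1)
    (hm2 : Function.Injective fun i => (m i).2) (k : ℕ) :
    Nat.card {p : (Fin k → SubsetsCard n y) × (Fin k → SubsetsCard n x) //
        ∀ e ∈ E, EvenWalk (fun s => tup (p.2 s) e.1) (fun s => tup (p.1 s) e.2)} ≤
      ((k + 1) ^ (2 * k) * n ^ (k + 1)) ^ q * (n ^ k) ^ (x + y - 2 * q) := by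
  have : Nonempty (Fin n) := ⟨⟨0, hn⟩⟩
  have h1 := card_evenWalk_le (V := Fin n) k
  have h2 := card_labellings_le (W := Fin k → Fin n) m hm1 hm2
    fun p => EvenWalk p.1 p.2
  simp only [Fintype.card_fin, Fintype.card_fun] at h1 h2
  refine le_trans ?_ (h2.trans (Nat.mul_le_mul_right _ (Nat.pow_le_pow_left h1 q)))
  refine Nat.card_le_card_of_injective (fun p => ⟨Sum.elim (fun i s => tup (p.1.2 s) i)
    (fun j s => tup (p.1.1 s) j), fun i => p.2 _ (hm i)⟩) ?_
  rintro ⟨⟨B, A⟩, _⟩ ⟨⟨B', A'⟩, _⟩ h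
  have h' := Subtype.ext_iff.1 h
  have hA : A = A' := funext fun s => eq_of_tup_eq <| funext fun i =>
    congrFun (congrFun h' (Sum.inl i)) s
  have hB : B = B' := funext fun s => eq_of_tup_eq <| funext fun j =>
    congrFun (congrFun h' (Sum.inr j)) s
  simp [hA, hB]

theorem sum_opNorm_colouredRH_pow_le (hn : 1 ≤ n) {q : ℕ} {E : Finset (Fin x × Fin y)}
    (m : Fin q → Fin x × Fin y) (hm : ∀ i, m i ∈ E) (hm1 : Function.Injective fun i => (m i).1)
    (hm2 : Function.Injective fun i => (m i).2) {k : ℕ} (hk : 1 ≤ k)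
    (c : Fin n → Fin x ⊕ Fin y) :
    ∑ g, opNorm (colouredRH c E g) ^ (2 * k) ≤
      (Fintype.card (Sym2 (Fin n) → Bool) : ℝ) *
        ((((k : ℝ) + 1) ^ (2 * k) * (n : ℝ) ^ (k + 1)) ^ q *
          ((n : ℝ) ^ k) ^ (x + y - 2 * q)) := by
  classical
  calc ∑ g, opNorm (colouredRH c E g) ^ (2 * k)
      ≤ ∑ g, ∑ B : Fin k → SubsetsCard n y, ∑ A : Fin k → SubsetsCard n x,
          ∏ s, (colouredRH c E g (A s) (B s) * colouredRH c E g (A s) (B (cyc s))) :=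
        sum_le_sum fun g _ => (opNorm_pow_le_trace _ hk).trans_eq
          (trace_transpose_mul_self_pow _ hk)
    _ = ∑ B : Fin k → SubsetsCard n y, ∑ A : Fin k → SubsetsCard n x, ∑ g,
          ∏ s, (colouredRH c E g (A s) (B s) * colouredRH c E g (A s) (B (cyc s))) := by
        rw [sum_comm]
        exact sum_congr rfl fun B _ => sum_comm
    _ ≤ ∑ B : Fin k → SubsetsCard n y, ∑ A : Fin k → SubsetsCard n x,
          (Fintype.card (Sym2 (Fin n) → Bool) : ℝ) *
            if ∀ e ∈ E, EvenWalk (fun s => tup (A s) e.1) (fun s => tup (B s) e.2)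
              then 1 else 0 :=
        sum_le_sum fun B _ => sum_le_sum fun A _ => sum_prod_colouredRH_le c E A B
    _ = (Fintype.card (Sym2 (Fin n) → Bool) : ℝ) *
          (Nat.card {p : (Fin k → SubsetsCard n y) × (Fin k → SubsetsCard n x) //
            ∀ e ∈ E, EvenWalk (fun s => tup (p.2 s) e.1) (fun s => tup (p.1 s) e.2)} : ℝ) := by
        rw [Nat.card_eq_fintype_card, Fintype.card_subtype, ← sum_boole, Fintype.sum_prod_type,
          mul_sum]
        simp only [mul_sum]
    _ ≤ _ := by
        refine mul_le_mul_of_nonneg_left ?_ (Nat.cast_nonneg _)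
        exact_mod_cast card_even_closed_walks_le hn m hm hm1 hm2 k

/-- The number of colourings that are prescribed on the image of an injection. -/
theorem card_colourings {V T : Type*} [Fintype V] [DecidableEq V] [Fintype T] [DecidableEq T]
    {f : T → V} (hf : Function.Injective f) :
    #{c : V → T | ∀ τ, c (f τ) = τ} * Fintype.card T ^ Fintype.card T =
      Fintype.card T ^ Fintype.card V := by
  classical
  have hset : ({c : V → T | ∀ τ, c (f τ) = τ} : Finset (V → T)) =
      Fintype.piFinset fun v => univ.filter fun τ' => ∀ τ, f τ = v → τ' = τ := by
    ext c
    simp only [mem_filter, mem_univ, true_and, Fintype.mem_piFinset]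
    exact ⟨fun h v τ hτ => hτ ▸ h τ, fun h τ => h _ τ rfl⟩
  have hcard : ∀ v, #(univ.filter fun τ' : T => ∀ τ, f τ = v → τ' = τ) =
      if v ∈ univ.image f then 1 else Fintype.card T := by
    intro v
    split_ifs with hv
    · obtain ⟨τ, -, rfl⟩ := mem_image.1 hv
      rw [card_eq_one]
      refine ⟨τ, ?_⟩
      ext τ'
      simp [hf.eq_iff]
    · rw [filter_true_of_mem, card_univ]
      intro τ' _ τ hτ
      exact absurd (mem_image.2 ⟨τ, mem_univ _, hτ⟩) hv
  have hle : Fintype.card T ≤ Fintype.card V := Fintype.card_le_of_injective f hf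
  rw [hset, Fintype.card_piFinset, prod_congr rfl fun v _ => hcard v, prod_ite, prod_const_one,
    one_mul, prod_const, ← pow_add]
  congr 1
  rw [filter_not, filter_mem_eq_inter, univ_inter, card_sdiff_of_subset (subset_univ _),
    card_image_of_injective _ hf, card_univ, card_univ]
  omega

theorem sum_colouredRH (hxy : 0 < x + y) (E : Finset (Fin x × Fin y))
    (g : Sym2 (Fin n) → Bool) :
    RH E g = (((x + y : ℕ) : ℝ) ^ (x + y)) •
      ∑ c : Fin n → Fin x ⊕ Fin y, (1 / ((x + y : ℕ) : ℝ) ^ n) • colouredRH c E g := by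
  have ht : ((x + y : ℕ) : ℝ) ≠ 0 := by positivity
  ext A B
  rw [← smul_sum]
  simp only [Matrix.smul_apply, Matrix.sum_apply, colouredRH, Matrix.of_apply, smul_eq_mul]
  by_cases hd : Disjoint A.1 B.1
  · have hf : Function.Injective (Sum.elim (tup A) (tup B)) :=
      (tup_injective A).sumElim (tup_injective B) fun i j h =>
        disjoint_left.1 hd (tup_mem A i) (h ▸ tup_mem B j)
    have hcount := card_colourings hf
    simp only [Fintype.card_sum, Fintype.card_fin, Sum.forall, Sum.elim_inl, Sum.elim_inr]
      at hcount
    rw [← sum_filter, sum_const, nsmul_eq_mul]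
    have hcount' : (#{c : Fin n → Fin x ⊕ Fin y | (∀ i, c (tup A i) = Sum.inl i) ∧
        ∀ j, c (tup B j) = Sum.inr j} : ℝ) * ((x + y : ℕ) : ℝ) ^ (x + y) =
        ((x + y : ℕ) : ℝ) ^ n := by
      exact_mod_cast hcount
    rw [mul_left_comm, ← mul_assoc, ← mul_assoc, mul_assoc (1 / _),
      mul_comm (((x + y : ℕ) : ℝ) ^ (x + y)), hcount', one_div,
      inv_mul_cancel₀ (pow_ne_zero _ ht), one_mul]
  · simp [RH, hd]

open scoped Matrix.Norms.L2Operator in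
theorem opNorm_RH_pow_le (hxy : 0 < x + y) (E : Finset (Fin x × Fin y))
    (g : Sym2 (Fin n) → Bool) (k : ℕ) :
    opNorm (RH E g) ^ k ≤ (((x + y : ℕ) : ℝ) ^ (x + y)) ^ k *
      ∑ c : Fin n → Fin x ⊕ Fin y,
        1 / ((x + y : ℕ) : ℝ) ^ n * opNorm (colouredRH c E g) ^ k := by
  have ht : ((x + y : ℕ) : ℝ) ≠ 0 := by positivity
  have hM : ∀ M : Matrix (SubsetsCard n x) (SubsetsCard n y) ℝ, opNorm M = ‖M‖ :=
    fun M => (Matrix.l2_opNorm_def M).symm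
  simp only [hM]
  have hnorm : ‖RH E g‖ ≤ ((x + y : ℕ) : ℝ) ^ (x + y) *
      ∑ c : Fin n → Fin x ⊕ Fin y, 1 / ((x + y : ℕ) : ℝ) ^ n * ‖colouredRH c E g‖ := by
    conv_lhs => rw [sum_colouredRH hxy E g]
    rw [norm_smul, Real.norm_of_nonneg (by positivity)]
    refine mul_le_mul_of_nonneg_left ((norm_sum_le _ _).trans_eq ?_) (by positivity)
    refine sum_congr rfl fun c _ => ?_
    rw [norm_smul, Real.norm_of_nonneg (by positivity)]
  refine (pow_le_pow_left₀ (norm_nonneg _) hnorm k).trans ?_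
  rw [mul_pow]
  refine mul_le_mul_of_nonneg_left ?_ (by positivity)
  refine Real.pow_arith_mean_le_arith_mean_pow _ _ _ (fun c _ => by positivity) ?_
    (fun c _ => norm_nonneg _) k
  simp only [sum_const, card_univ, Fintype.card_fun, Fintype.card_sum, Fintype.card_fin,
    nsmul_eq_mul]
  push_cast
  push_cast at ht
  field_simp

theorem sum_opNorm_RH_pow_le (hn : 1 ≤ n) (hxy : 0 < x + y) {q : ℕ} {E : Finset (Fin x × Fin y)}
    (m : Fin q → Fin x × Fin y) (hm : ∀ i, m i ∈ E) (hm1 : Function.Injective fun i => (m i).1)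
    (hm2 : Function.Injective fun i => (m i).2) {k : ℕ} (hk : 1 ≤ k) :
    ∑ g : Sym2 (Fin n) → Bool, opNorm (RH E g) ^ (2 * k) ≤
      (Fintype.card (Sym2 (Fin n) → Bool) : ℝ) * ((((x + y : ℕ) : ℝ) ^ (x + y)) ^ (2 * k) *
        ((((k : ℝ) + 1) ^ (2 * k) * (n : ℝ) ^ (k + 1)) ^ q *
          ((n : ℝ) ^ k) ^ (x + y - 2 * q))) := by
  have ht : ((x + y : ℕ) : ℝ) ≠ 0 := by positivity
  set N : ℝ := (((k : ℝ) + 1) ^ (2 * k) * (n : ℝ) ^ (k + 1)) ^ q *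
    ((n : ℝ) ^ k) ^ (x + y - 2 * q) with hN
  set Ω : ℝ := (Fintype.card (Sym2 (Fin n) → Bool) : ℝ) with hΩ
  refine (sum_le_sum fun g _ => opNorm_RH_pow_le hxy E g (2 * k)).trans ?_
  rw [← mul_sum, sum_comm]
  simp only [← mul_sum]
  have h : ∑ c : Fin n → Fin x ⊕ Fin y, ∑ g, opNorm (colouredRH c E g) ^ (2 * k) ≤
      ((x + y : ℕ) : ℝ) ^ n * (Ω * N) := by
    refine (sum_le_card_nsmul _ _ _ fun c _ =>
      sum_opNorm_colouredRH_pow_le hn m hm hm1 hm2 hk c).trans_eq ?_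
    simp [hΩ, hN]
  calc _ ≤ (((x + y : ℕ) : ℝ) ^ (x + y)) ^ (2 * k) *
        (1 / ((x + y : ℕ) : ℝ) ^ n * (((x + y : ℕ) : ℝ) ^ n * (Ω * N))) := by gcongr
    _ = _ := by field_simp

end Restricted

theorem Pr_mul_pow_le {n : ℕ} (F : (Sym2 (Fin n) → Bool) → ℝ) (hF : ∀ g, 0 ≤ F g) {T : ℝ}
    (hT : 0 ≤ T) (p : ℕ) :
    Pr (fun g => T < F g) * T ^ p ≤ (∑ g, F g ^ p) / Fintype.card (Sym2 (Fin n) → Bool) := by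
  classical
  unfold Pr
  rw [div_mul_eq_mul_div]
  refine div_le_div_of_nonneg_right ?_ (Nat.cast_nonneg _)
  rw [← nsmul_eq_mul]
  refine (card_nsmul_le_sum _ (fun g => F g ^ p) _ fun g hg => ?_).trans
    (sum_le_sum_of_subset_of_nonneg (subset_univ _) fun g _ _ => pow_nonneg (hF g) p)
  exact pow_le_pow_left₀ hT (by simpa using (mem_filter.1 hg).2.le) p

theorem moment_lt_threshold {n t q k : ℕ} (hn : 1 ≤ n) (hq : 1 ≤ q) (htq : 2 * q ≤ t)
    (hk : 1 ≤ k) {ε X : ℝ} (hε : 0 < ε) (hX : (k : ℝ) ≤ X)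
    (hL : Real.log (8 * (n : ℝ) ^ q / ε) ≤ 2 * q * k) :
    ((t : ℝ) ^ t) ^ (2 * k) *
        ((((k : ℝ) + 1) ^ (2 * k) * (n : ℝ) ^ (k + 1)) ^ q * ((n : ℝ) ^ k) ^ (t - 2 * q)) <
      ε * (2 * (t : ℝ) ^ t * (Real.exp 1 * t * X) ^ q * (n : ℝ) ^ (((t : ℝ) - q) / 2)) ^
        (2 * k) := by
  obtain ⟨d, rfl⟩ := Nat.exists_eq_add_of_le htq
  set t := 2 * q + d with ht
  have hn0 : (0 : ℝ) < n := by exact_mod_cast hn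
  have ht2 : (2 : ℝ) ≤ t := by exact_mod_cast (by omega : 2 ≤ t)
  have hk1 : (1 : ℝ) ≤ k := by exact_mod_cast hk
  have hrpow : ((n : ℝ) ^ (((t : ℝ) - q) / 2)) ^ (2 * k) = (n : ℝ) ^ ((q + d) * k) := by
    rw [← Real.rpow_natCast, ← Real.rpow_mul hn0.le, ← Real.rpow_natCast]
    congr 1
    rw [ht]
    push_cast
    ring
  have hexp : 8 * (n : ℝ) ^ q ≤ ε * Real.exp 1 ^ (2 * q * k) := by
    have h := (Real.log_le_iff_le_exp (by positivity)).1 hL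
    rw [div_le_iff₀ hε] at h
    rw [← Real.exp_nat_mul]
    push_cast
    rw [mul_one]
    linarith
  have hbase : ((k : ℝ) + 1) ^ (2 * q * k) ≤ (t * X) ^ (2 * q * k) := by
    refine pow_le_pow_left₀ (by positivity) ?_ _
    nlinarith
  have hfour : (1 : ℝ) ≤ 2 ^ (2 * k) := one_le_pow₀ (by norm_num)
  have hnq : (0 : ℝ) < (n : ℝ) ^ q := by positivity
  have hlt : ((k : ℝ) + 1) ^ (2 * q * k) * (n : ℝ) ^ q <
      2 ^ (2 * k) * ((t * X) ^ (2 * q * k) * (ε * Real.exp 1 ^ (2 * q * k))) :=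
    calc ((k : ℝ) + 1) ^ (2 * q * k) * (n : ℝ) ^ q
        < ((k : ℝ) + 1) ^ (2 * q * k) * (8 * (n : ℝ) ^ q) :=
          mul_lt_mul_of_pos_left (by linarith) (by positivity)
      _ ≤ (t * X) ^ (2 * q * k) * (ε * Real.exp 1 ^ (2 * q * k)) :=
          mul_le_mul hbase hexp (by positivity) ((by positivity : (0 : ℝ) ≤ _).trans hbase)
      _ ≤ _ := le_mul_of_one_le_left
          (mul_nonneg ((by positivity : (0 : ℝ) ≤ _).trans hbase) (by positivity)) hfour
  have hpos : (0 : ℝ) < ((t : ℝ) ^ t) ^ (2 * k) * (n : ℝ) ^ ((q + d) * k) := by positivity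
  calc _ = ((t : ℝ) ^ t) ^ (2 * k) * (n : ℝ) ^ ((q + d) * k) *
        (((k : ℝ) + 1) ^ (2 * q * k) * (n : ℝ) ^ q) := by
          rw [show t - 2 * q = d by omega]
          ring
    _ < ((t : ℝ) ^ t) ^ (2 * k) * (n : ℝ) ^ ((q + d) * k) *
        (2 ^ (2 * k) * ((t * X) ^ (2 * q * k) * (ε * Real.exp 1 ^ (2 * q * k)))) :=
          mul_lt_mul_of_pos_left hlt hpos
    _ = _ := by
          rw [mul_pow _ ((n : ℝ) ^ _), hrpow]
          ring

end Moments

theorem stmt8 (n x y q : ℕ) (hn : 1 ≤ n) (E : Finset (Fin x × Fin y))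
    (hq : IsLeast {m | ∃ S : Finset (Fin x ⊕ Fin y), IsVertexCover E S ∧ S.card = m} q)
    (hq1 : 1 ≤ q) (ε : ℝ) (hε0 : 0 < ε) (hε1 : ε < 1) :
    Pr (fun g : Sym2 (Fin n) → Bool =>
        2 * ((x + y : ℕ) : ℝ) ^ (x + y) *
            (Real.exp 1 * ((x + y : ℕ) : ℝ) *
              (Real.log (8 * (n : ℝ) ^ q / ε) / (2 * (q : ℝ)) + 1)) ^ q *
            (n : ℝ) ^ ((((x + y : ℕ) : ℝ) - (q : ℝ)) / 2)
          < opNorm (RH E g)) < ε := by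
  obtain ⟨m, hm, hm1, hm2⟩ := exists_matching_of_isLeast_cover hq
  have htq : 2 * q ≤ x + y := by simpa using two_mul_card_matching_le m hm1 hm2
  have hn0 : (1 : ℝ) ≤ n := by exact_mod_cast hn
  have hq0 : (0 : ℝ) < q := by exact_mod_cast hq1
  have ht0 : (0 : ℝ) < ((x + y : ℕ) : ℝ) := by exact_mod_cast (by omega : 0 < x + y)
  set L := Real.log (8 * (n : ℝ) ^ q / ε) with hL
  have hL0 : 0 < L := by
    refine Real.log_pos ?_
    rw [lt_div_iff₀ hε0]
    nlinarith [one_le_pow₀ hn0 (n := q)]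
  set k := ⌈L / (2 * (q : ℝ))⌉₊ with hk
  have hk1 : 1 ≤ k := Nat.ceil_pos.2 (by positivity)
  have hLk : L ≤ 2 * q * k := by
    have := Nat.le_ceil (L / (2 * (q : ℝ)))
    rw [div_le_iff₀ (by positivity)] at this
    linarith
  have hX : (k : ℝ) ≤ L / (2 * (q : ℝ)) + 1 := (Nat.ceil_lt_add_one (by positivity)).le
  set T := 2 * ((x + y : ℕ) : ℝ) ^ (x + y) *
    (Real.exp 1 * ((x + y : ℕ) : ℝ) * (L / (2 * (q : ℝ)) + 1)) ^ q *
    (n : ℝ) ^ ((((x + y : ℕ) : ℝ) - (q : ℝ)) / 2) with hT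
  have hT0 : 0 < T := by positivity
  have hmarkov := Pr_mul_pow_le (fun g : Sym2 (Fin n) → Bool => opNorm (RH E g))
    (fun g => norm_nonneg _) hT0.le (2 * k)
  have hmoment := sum_opNorm_RH_pow_le hn (by omega) m hm hm1 hm2 hk1
  rw [← div_le_iff₀' (by positivity)] at hmoment
  have hlt := moment_lt_threshold hn hq1 htq hk1 hε0 hX hLk
  exact lt_of_mul_lt_mul_right ((hmarkov.trans hmoment).trans_lt hlt) (by positivity)
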